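/- arXiv:1912.04429 — 2 statements merged into one kernel-verified Lean document; each statement's English description precedes it below -/
import Mathlib

section
/- Family of stationary solutions of the 3D self-similar Burgers equation (Proposition A.1 of the paper): Let A be a real-valued function on the multi-indices α ∈ ℕ³ with |α| = 3, and suppose that the symmetric 3×3 matrix M with entries M_{jk} = A(e₁ + e_j + e_k) (j,k ∈ {1,2,3}) is positive definite. Then there exists a C^∞ function W̄_A : ℝ³ → ℝ such that: (i) W̄_A satisfies −(1/2)W̄_A + ((3/2)y₁ + W̄_A)∂_{y₁}W̄_A + (1/2)y₂∂_{y₂}W̄_A + (1/2)y₃∂_{y₃}W̄_A = 0 at every y ∈ ℝ³; (ii) W̄_A(0) = 0, ∂₁W̄_A(0) = −1, ∂₂W̄_A(0) = 0 and ∂₃W̄_A(0) = 0; (iii) ∂^αW̄_A(0) = 0 for every multi-index α with |α| even; (iv) ∂^αW̄_A(0) = A(α) for every multi-index α with |α| = 3. -/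
noncomputable section

/-- Points of self-similar space `ℝ³`. -/
abbrev V3 : Type := Fin 3 → ℝ

/-- Spatial partial derivative `∂ⱼ g` of a scalar function on `ℝ³`. -/
def pdS (j : Fin 3) (g : V3 → ℝ) (x : V3) : ℝ :=
  fderiv ℝ g x (Pi.single j 1 : V3)

/-- `n`-fold iterated partial derivative in the `j`-th direction. -/
def pdIter (j : Fin 3) : ℕ → (V3 → ℝ) → V3 → ℝ
  | 0, g => g
  | n + 1, g => pdS j (pdIter j n g)

/-- The multi-index partial derivative `∂^α = ∂₁^{α₁} ∂₂^{α₂} ∂₃^{α₃}`. -/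
def mpd (m : Fin 3 → ℕ) (g : V3 → ℝ) : V3 → ℝ :=
  pdIter 0 (m 0) (pdIter 1 (m 1) (pdIter 2 (m 2) g))


/-- The cubic form with Taylor data `A`. -/
def cub (A : (Fin 3 → ℕ) → ℝ) (u v w : ℝ) : ℝ :=
  A ![3,0,0] / 6 * u^3 + A ![2,1,0] / 2 * (u^2*v) + A ![2,0,1] / 2 * (u^2*w)
  + A ![1,2,0] / 2 * (u*v^2) + A ![1,1,1] * (u*v*w) + A ![1,0,2] / 2 * (u*w^2)
  + A ![0,3,0] / 6 * v^3 + A ![0,2,1] / 2 * (v^2*w) + A ![0,1,2] / 2 * (v*w^2)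
  + A ![0,0,3] / 6 * w^3

def cub0 (A : (Fin 3 → ℕ) → ℝ) (u v w : ℝ) : ℝ :=
  A ![3,0,0] / 2 * u^2 + A ![2,1,0] * (u*v) + A ![2,0,1] * (u*w)
  + A ![1,2,0] / 2 * (v^2) + A ![1,1,1] * (v*w) + A ![1,0,2] / 2 * (w^2)

def cub1 (A : (Fin 3 → ℕ) → ℝ) (u v w : ℝ) : ℝ :=
  A ![2,1,0] / 2 * (u^2)
  + A ![1,2,0] * (u*v) + A ![1,1,1] * (u*w)
  + A ![0,3,0] / 2 * v^2 + A ![0,2,1] * (v*w) + A ![0,1,2] / 2 * (w^2)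

def cub2 (A : (Fin 3 → ℕ) → ℝ) (u v w : ℝ) : ℝ :=
  A ![2,0,1] / 2 * (u^2)
  + A ![1,1,1] * (u*v) + A ![1,0,2] * (u*w)
  + A ![0,2,1] / 2 * (v^2) + A ![0,1,2] * (v*w)
  + A ![0,0,3] / 2 * w^2

lemma cub_euler (A : (Fin 3 → ℕ) → ℝ) (u v w : ℝ) :
    u * cub0 A u v w + v * cub1 A u v w + w * cub2 A u v w = 3 * cub A u v w := by
  unfold cub cub0 cub1 cub2; ring

lemma cub_neg (A : (Fin 3 → ℕ) → ℝ) (u v w : ℝ) :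
    cub A (-u) (-v) (-w) = - cub A u v w := by
  unfold cub; ring

lemma cub_hasFDerivAt {E : Type*} [NormedAddCommGroup E] [NormedSpace ℝ E]
    (A : (Fin 3 → ℕ) → ℝ) {f g h : E → ℝ} {f' g' h' : E →L[ℝ] ℝ} {x : E}
    (hf : HasFDerivAt f f' x) (hg : HasFDerivAt g g' x) (hh : HasFDerivAt h h' x) :
    HasFDerivAt (fun y => cub A (f y) (g y) (h y))
      (cub0 A (f x) (g x) (h x) • f' + cub1 A (f x) (g x) (h x) • g'
        + cub2 A (f x) (g x) (h x) • h') x := by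
  have H := (((((((((((hf.pow 3).const_mul (A ![3,0,0] / 6)).add
    (((hf.pow 2).mul hg).const_mul (A ![2,1,0] / 2))).add
    (((hf.pow 2).mul hh).const_mul (A ![2,0,1] / 2))).add
    ((hf.mul (hg.pow 2)).const_mul (A ![1,2,0] / 2))).add
    (((hf.mul hg).mul hh).const_mul (A ![1,1,1]))).add
    ((hf.mul (hh.pow 2)).const_mul (A ![1,0,2] / 2))).add
    ((hg.pow 3).const_mul (A ![0,3,0] / 6))).add
    (((hg.pow 2).mul hh).const_mul (A ![0,2,1] / 2))).add
    ((hg.mul (hh.pow 2)).const_mul (A ![0,1,2] / 2))).add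
    ((hh.pow 3).const_mul (A ![0,0,3] / 6)))
  refine H.congr_fderiv ?_
  ext e
  simp [cub0, cub1, cub2]
  ring

lemma cub_contDiff {E : Type*} [NormedAddCommGroup E] [NormedSpace ℝ E]
    (A : (Fin 3 → ℕ) → ℝ) {f g h : E → ℝ}
    (hf : ContDiff ℝ (⊤ : ℕ∞) f) (hg : ContDiff ℝ (⊤ : ℕ∞) g) (hh : ContDiff ℝ (⊤ : ℕ∞) h) :
    ContDiff ℝ (⊤ : ℕ∞) (fun y => cub A (f y) (g y) (h y)) := by
  unfold cub; fun_prop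

lemma cub0_nonneg (A : (Fin 3 → ℕ) → ℝ)
    (hA : (Matrix.of (fun j k : Fin 3 =>
        A (Pi.single 0 1 + Pi.single j 1 + Pi.single k 1))).PosDef) (u v w : ℝ) :
    0 ≤ cub0 A u v w := by
  have h := hA.posSemidef.dotProduct_mulVec_nonneg ![u, v, w]
  have e1 : (Pi.single 0 1 + Pi.single 0 1 + Pi.single 0 1 : Fin 3 → ℕ) = ![3,0,0] := by decide
  have e2 : (Pi.single 0 1 + Pi.single 0 1 + Pi.single 1 1 : Fin 3 → ℕ) = ![2,1,0] := by decide
  have e3 : (Pi.single 0 1 + Pi.single 0 1 + Pi.single 2 1 : Fin 3 → ℕ) = ![2,0,1] := by decide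
  have e4 : (Pi.single 0 1 + Pi.single 1 1 + Pi.single 0 1 : Fin 3 → ℕ) = ![2,1,0] := by decide
  have e5 : (Pi.single 0 1 + Pi.single 1 1 + Pi.single 1 1 : Fin 3 → ℕ) = ![1,2,0] := by decide
  have e6 : (Pi.single 0 1 + Pi.single 1 1 + Pi.single 2 1 : Fin 3 → ℕ) = ![1,1,1] := by decide
  have e7 : (Pi.single 0 1 + Pi.single 2 1 + Pi.single 0 1 : Fin 3 → ℕ) = ![2,0,1] := by decide
  have e8 : (Pi.single 0 1 + Pi.single 2 1 + Pi.single 1 1 : Fin 3 → ℕ) = ![1,1,1] := by decide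
  have e9 : (Pi.single 0 1 + Pi.single 2 1 + Pi.single 2 1 : Fin 3 → ℕ) = ![1,0,2] := by decide
  simp only [dotProduct, Matrix.mulVec, Fin.sum_univ_three, Matrix.of_apply, e1, e2, e3, e4, e5,
    e6, e7, e8, e9, Pi.star_apply, star_trivial, Matrix.cons_val_zero, Matrix.cons_val_one,
    Matrix.cons_val] at h
  unfold cub0
  nlinarith [h]

lemma cub_mono (A : (Fin 3 → ℕ) → ℝ) (h0 : ∀ u v w, 0 ≤ cub0 A u v w) (v w : ℝ) :
    Monotone (fun u => cub A u v w) := by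
  have hd : ∀ u, HasDerivAt (fun u => cub A u v w) (cub0 A u v w) u := by
    intro u
    have := (cub_hasFDerivAt A (hasFDerivAt_id u) (hasFDerivAt_const v u)
      (hasFDerivAt_const w u)).hasDerivAt
    simpa using this
  exact monotone_of_deriv_nonneg (fun u => (hd u).differentiableAt)
    (fun u => by rw [(hd u).deriv]; exact h0 _ _ _)

lemma cub_bij (A : (Fin 3 → ℕ) → ℝ) (h0 : ∀ u v w, 0 ≤ cub0 A u v w) (v w : ℝ) :
    Function.Bijective (fun u => u + cub A u v w) := by
  have hm := cub_mono A h0 v w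
  have hs : StrictMono (fun u => u + cub A u v w) := strictMono_id.add_monotone hm
  refine ⟨hs.injective, ?_⟩
  refine Continuous.surjective (by unfold cub; fun_prop) ?_ ?_
  · refine Filter.tendsto_atTop_mono' _ ?_
      (Filter.tendsto_atTop_add_const_right _ (cub A 0 v w) Filter.tendsto_id)
    filter_upwards [Filter.eventually_ge_atTop 0] with u hu
    simpa using hm hu
  · refine Filter.tendsto_atBot_mono' _ ?_
      (Filter.tendsto_atBot_add_const_right _ (cub A 0 v w) Filter.tendsto_id)
    filter_upwards [Filter.eventually_le_atBot 0] with u hu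
    simpa using hm hu

lemma proj_contDiff (j : Fin 3) : ContDiff ℝ (⊤ : ℕ∞) (fun y : V3 => y j) := by fun_prop

lemma proj_hasFDerivAt (j : Fin 3) (x : V3) :
    HasFDerivAt (fun y : V3 => y j) (ContinuousLinearMap.proj (R := ℝ) (φ := fun _ : Fin 3 => ℝ) j) x :=
  (ContinuousLinearMap.proj (R := ℝ) (φ := fun _ : Fin 3 => ℝ) j).hasFDerivAt

def Phi (A : (Fin 3 → ℕ) → ℝ) (y : V3) : V3 := ![y 0 + cub A (y 0) (y 1) (y 2), y 1, y 2]

lemma Phi_contDiff (A : (Fin 3 → ℕ) → ℝ) : ContDiff ℝ (⊤ : ℕ∞) (Phi A) := by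
  rw [contDiff_pi]
  intro i
  fin_cases i
  · exact (proj_contDiff 0).add (cub_contDiff A (proj_contDiff 0) (proj_contDiff 1) (proj_contDiff 2))
  · exact proj_contDiff 1
  · exact proj_contDiff 2

lemma Phi_bij (A : (Fin 3 → ℕ) → ℝ) (h0 : ∀ u v w, 0 ≤ cub0 A u v w) :
    Function.Bijective (Phi A) := by
  constructor
  · intro x y h
    have e0 := congrFun h 0
    have e1 : x 1 = y 1 := congrFun h 1
    have e2 : x 2 = y 2 := congrFun h 2
    simp only [Phi, Matrix.cons_val_zero, e1, e2] at e0
    have e0' := (cub_bij A h0 (y 1) (y 2)).1 e0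
    ext i
    fin_cases i
    · exact e0'
    · exact e1
    · exact e2
  · intro y
    obtain ⟨u, hu⟩ := (cub_bij A h0 (y 1) (y 2)).2 (y 0)
    refine ⟨![u, y 1, y 2], ?_⟩
    ext i
    fin_cases i
    · exact hu
    · rfl
    · rfl

lemma Phi_deriv (A : (Fin 3 → ℕ) → ℝ) (h0 : ∀ u v w, 0 ≤ cub0 A u v w) (x : V3) :
    ∃ e : V3 ≃L[ℝ] V3, HasFDerivAt (Phi A) (e : V3 →L[ℝ] V3) x := by
  have hd : DifferentiableAt ℝ (Phi A) x := (Phi_contDiff A).differentiable (by simp) x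
  have hF := hasFDerivAt_pi'.1 hd.hasFDerivAt
  have k0 := (hF 0).unique ((proj_hasFDerivAt 0 x).add
    (cub_hasFDerivAt A (proj_hasFDerivAt 0 x) (proj_hasFDerivAt 1 x) (proj_hasFDerivAt 2 x)))
  have k1 := (hF 1).unique (proj_hasFDerivAt 1 x)
  have k2 := (hF 2).unique (proj_hasFDerivAt 2 x)
  have inj : Function.Injective (fderiv ℝ (Phi A) x : V3 →ₗ[ℝ] V3) := by
    rw [← LinearMap.ker_eq_bot, LinearMap.ker_eq_bot']
    intro v hv
    have hv' : fderiv ℝ (Phi A) x v = 0 := hv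
    have l0 := DFunLike.congr_fun k0 v
    have l1 := DFunLike.congr_fun k1 v
    have l2 := DFunLike.congr_fun k2 v
    simp [hv'] at l0 l1 l2
    rw [← l1, ← l2] at l0
    have hp := h0 (x 0) (x 1) (x 2)
    have : v 0 = 0 := by
      have : (1 + cub0 A (x 0) (x 1) (x 2)) * v 0 = 0 := by linarith
      rcases mul_eq_zero.1 this with h | h
      · linarith
      · exact h
    ext i
    fin_cases i
    · exact this
    · exact l1.symm
    · exact l2.symm
  refine ⟨(LinearEquiv.ofInjectiveEndo _ inj).toContinuousLinearEquiv, ?_⟩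
  refine hd.hasFDerivAt.congr_fderiv ?_
  ext v
  rfl

lemma exists_U (A : (Fin 3 → ℕ) → ℝ) (h0 : ∀ u v w, 0 ≤ cub0 A u v w) :
    ∃ U : V3 → ℝ, ContDiff ℝ (⊤ : ℕ∞) U ∧ ∀ y, U y + cub A (U y) (y 1) (y 2) = y 0 := by
  choose e he using Phi_deriv A h0
  have hopen : IsOpenMap (Phi A) := isOpenMap_of_hasStrictFDerivAt_equiv
    (fun x => ((Phi_contDiff A).contDiffAt.hasStrictFDerivAt' (he x) (by simp)))
  let H : V3 ≃ₜ V3 := (Equiv.ofBijective _ (Phi_bij A h0)).toHomeomorphOfContinuousOpen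
    (Phi_contDiff A).continuous hopen
  have hH : ContDiff ℝ (⊤ : ℕ∞) (H.symm : V3 → V3) :=
    H.contDiff_symm (f₀' := e) he (Phi_contDiff A)
  refine ⟨fun y => H.symm y 0, (proj_contDiff 0).comp hH, fun y => ?_⟩
  have hy : Phi A (H.symm y) = y := H.apply_symm_apply y
  have a0 := congrFun hy 0
  have a1 : H.symm y 1 = y 1 := congrFun hy 1
  have a2 : H.symm y 2 = y 2 := congrFun hy 2
  rw [← a1, ← a2]
  exact a0

/-! Derivative calculus -/

lemma pdS_contDiff (j : Fin 3) {f : V3 → ℝ} (hf : ContDiff ℝ (⊤ : ℕ∞) f) :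
    ContDiff ℝ (⊤ : ℕ∞) (pdS j f) := by
  have : ContDiff ℝ (⊤ : ℕ∞) (fderiv ℝ f) := hf.fderiv_right (by simp)
  exact this.clm_apply contDiff_const

lemma pdS_add (j : Fin 3) {f g : V3 → ℝ} (hf : ContDiff ℝ (⊤ : ℕ∞) f)
    (hg : ContDiff ℝ (⊤ : ℕ∞) g) : pdS j (fun y => f y + g y) = fun y => pdS j f y + pdS j g y := by
  ext x
  have h1 := (hf.differentiable (by simp) x).hasFDerivAt
  have h2 := (hg.differentiable (by simp) x).hasFDerivAt
  simp [pdS, (h1.fun_add h2).fderiv]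

lemma pdS_mul (j : Fin 3) {f g : V3 → ℝ} (hf : ContDiff ℝ (⊤ : ℕ∞) f)
    (hg : ContDiff ℝ (⊤ : ℕ∞) g) :
    pdS j (fun y => f y * g y) = fun y => pdS j f y * g y + f y * pdS j g y := by
  ext x
  have h1 := (hf.differentiable (by simp) x).hasFDerivAt
  have h2 := (hg.differentiable (by simp) x).hasFDerivAt
  simp [pdS, (h1.fun_mul h2).fderiv]
  ring

lemma pdS_neg_symm (j : Fin 3) {f : V3 → ℝ} {s : ℝ} (h : ∀ y, f (-y) = s * f y) (y : V3) :
    pdS j f (-y) = (-s) * pdS j f y := by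
  have h1 : (fun y => f (-y)) = fun y => s • f y := funext h
  have h2 := congrArg (fun g => fderiv ℝ g y) h1
  have h5 := (ContinuousLinearEquiv.neg ℝ (M := V3)).comp_right_fderiv (f := f) (x := y)
  have h6 : (f ∘ (ContinuousLinearEquiv.neg ℝ (M := V3))) = fun y => f (-y) := rfl
  rw [h6] at h5
  simp only [h5] at h2
  have h3 := DFunLike.congr_fun h2 (Pi.single j 1)
  rw [show (fun y => s • f y) = s • f from rfl, fderiv_const_smul_field] at h3
  simp at h3
  simp only [pdS]
  linarith

lemma pdIter_neg_symm (j : Fin 3) (n : ℕ) {f : V3 → ℝ} {s : ℝ} (h : ∀ y, f (-y) = s * f y) :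
    ∀ y, pdIter j n f (-y) = ((-1)^n * s) * pdIter j n f y := by
  induction n with
  | zero => simpa [pdIter] using h
  | succ n ih =>
    intro y
    rw [pdIter, pdS_neg_symm j ih]
    ring

lemma pdIter_contDiff (j : Fin 3) (n : ℕ) {f : V3 → ℝ} (hf : ContDiff ℝ (⊤ : ℕ∞) f) :
    ContDiff ℝ (⊤ : ℕ∞) (pdIter j n f) := by
  induction n with
  | zero => exact hf
  | succ n ih => exact pdS_contDiff j ih

lemma pdIter_add (j : Fin 3) (n : ℕ) {f g : V3 → ℝ} (hf : ContDiff ℝ (⊤ : ℕ∞) f)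
    (hg : ContDiff ℝ (⊤ : ℕ∞) g) :
    pdIter j n (fun y => f y + g y) = fun y => pdIter j n f y + pdIter j n g y := by
  induction n with
  | zero => rfl
  | succ n ih =>
    simp only [pdIter]
    rw [ih, pdS_add j (pdIter_contDiff j n hf) (pdIter_contDiff j n hg)]

lemma mpd_add (m : Fin 3 → ℕ) {f g : V3 → ℝ} (hf : ContDiff ℝ (⊤ : ℕ∞) f)
    (hg : ContDiff ℝ (⊤ : ℕ∞) g) :
    mpd m (fun y => f y + g y) = fun y => mpd m f y + mpd m g y := by
  unfold mpd
  rw [pdIter_add 2 _ hf hg, pdIter_add 1 _ (pdIter_contDiff _ _ hf) (pdIter_contDiff _ _ hg),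
    pdIter_add 0 _ (pdIter_contDiff _ _ (pdIter_contDiff _ _ hf))
      (pdIter_contDiff _ _ (pdIter_contDiff _ _ hg))]

/-- Smooth functions vanishing to order `k` at the origin. -/
def Van : ℕ → (V3 → ℝ) → Prop
  | 0, f => ContDiff ℝ (⊤ : ℕ∞) f
  | k + 1, f => ContDiff ℝ (⊤ : ℕ∞) f ∧ f 0 = 0 ∧ ∀ j, Van k (pdS j f)

lemma Van.smooth {k : ℕ} {f : V3 → ℝ} (h : Van k f) : ContDiff ℝ (⊤ : ℕ∞) f := by
  cases k with
  | zero => exact h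
  | succ k => exact h.1

lemma Van.pred {k : ℕ} {f : V3 → ℝ} (h : Van (k+1) f) : Van k f := by
  induction k generalizing f with
  | zero => exact h.1
  | succ k ih => exact ⟨h.1, h.2.1, fun j => ih (h.2.2 j)⟩

lemma Van.add {k : ℕ} {f g : V3 → ℝ} (hf : Van k f) (hg : Van k g) :
    Van k (fun y => f y + g y) := by
  induction k generalizing f g with
  | zero => exact ContDiff.add hf hg
  | succ k ih =>
    refine ⟨ContDiff.add hf.1 hg.1, by simp [hf.2.1, hg.2.1], fun j => ?_⟩
    rw [pdS_add j hf.1 hg.1]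
    exact ih (hf.2.2 j) (hg.2.2 j)

lemma Van.mul {n a b : ℕ} (hn : a + b = n) {f g : V3 → ℝ} (hf : Van a f) (hg : Van b g) :
    Van n (fun y => f y * g y) := by
  induction n generalizing a b f g with
  | zero => exact ContDiff.mul hf.smooth hg.smooth
  | succ n ih =>
    refine ⟨ContDiff.mul hf.smooth hg.smooth, ?_, fun j => ?_⟩
    · cases a with
      | succ a => simp [hf.2.1]
      | zero =>
        cases b with
        | succ b => simp [hg.2.1]
        | zero => omega
    · rw [pdS_mul j hf.smooth hg.smooth]
      refine Van.add ?_ ?_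
      · cases a with
        | succ a => exact ih (a := a) (b := b) (by omega) (hf.2.2 j) hg
        | zero =>
          cases b with
          | succ b => exact ih (a := 0) (b := b) (by omega) (pdS_contDiff j hf) hg.pred
          | zero => omega
      · cases b with
        | succ b => exact ih (a := a) (b := b) (by omega) hf (hg.2.2 j)
        | zero =>
          cases a with
          | succ a => exact ih (a := a) (b := 0) (by omega) hf.pred (pdS_contDiff j hg)
          | zero => omega

lemma Van.cmul {k : ℕ} (c : ℝ) {f : V3 → ℝ} (hf : Van k f) : Van k (fun y => c * f y) :=
  Van.mul (a := 0) (b := k) (by omega) (f := fun _ => c) contDiff_const hf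

lemma Van.one {f : V3 → ℝ} (hf : ContDiff ℝ (⊤ : ℕ∞) f) (h : f 0 = 0) : Van 1 f :=
  ⟨hf, h, fun j => pdS_contDiff j hf⟩

lemma Van.mul3 {f g h : V3 → ℝ} (hf : Van 1 f) (hg : Van 1 g) (hh : Van 1 h) :
    Van 3 (fun y => f y * g y * h y) :=
  Van.mul (a := 2) (b := 1) rfl (Van.mul (a := 1) (b := 1) rfl hf hg) hh

lemma Van.cub {f g h : V3 → ℝ} (A : (Fin 3 → ℕ) → ℝ) (hf : Van 1 f) (hg : Van 1 g) (hh : Van 1 h) :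
    Van 3 (fun y => _root_.cub A (f y) (g y) (h y)) := by
  have H := (((((((((((hf.mul3 hf hf).cmul (A ![3,0,0] / 6)).add
    ((hf.mul3 hf hg).cmul (A ![2,1,0] / 2))).add
    ((hf.mul3 hf hh).cmul (A ![2,0,1] / 2))).add
    ((hf.mul3 hg hg).cmul (A ![1,2,0] / 2))).add
    ((hf.mul3 hg hh).cmul (A ![1,1,1]))).add
    ((hf.mul3 hh hh).cmul (A ![1,0,2] / 2))).add
    ((hg.mul3 hg hg).cmul (A ![0,3,0] / 6))).add
    ((hg.mul3 hg hh).cmul (A ![0,2,1] / 2))).add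
    ((hg.mul3 hh hh).cmul (A ![0,1,2] / 2))).add
    ((hh.mul3 hh hh).cmul (A ![0,0,3] / 6)))
  convert H using 2
  unfold _root_.cub
  ring

/-- Divided difference of the cubic in its first variable. -/
lemma cub_sub (A : (Fin 3 → ℕ) → ℝ) (u t v w : ℝ) :
    cub A u v w - cub A t v w = (u - t) *
      (A ![3,0,0] / 6 * (u * u + u * t + t * t) + (A ![2,1,0] / 2 * v + A ![2,0,1] / 2 * w) * (u + t)
       + (A ![1,2,0] / 2 * v^2 + A ![1,1,1] * (v * w) + A ![1,0,2] / 2 * w^2)) := by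
  unfold cub; ring

lemma Van.pdIter {k n : ℕ} (j : Fin 3) {f : V3 → ℝ} (hf : Van (n + k) f) :
    Van k (pdIter j n f) := by
  induction n generalizing k with
  | zero => rw [Nat.zero_add] at hf; exact hf
  | succ n ih =>
    have : Van (k+1) (_root_.pdIter j n f) := ih (by convert hf using 1; ring)
    exact this.2.2 j

lemma Van.mpd {f : V3 → ℝ} (m : Fin 3 → ℕ) (hf : Van (m 0 + m 1 + m 2 + 1) f) :
    mpd m f 0 = 0 := by
  have : Van 1 (_root_.mpd m f) := by
    refine Van.pdIter 0 (Van.pdIter 1 (Van.pdIter 2 ?_))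
    convert hf using 1; ring
  exact this.2.1

def mono3 (c : ℝ) (p q r : ℕ) (y : V3) : ℝ := c * (y 0 ^ p * y 1 ^ q * y 2 ^ r)

lemma mono3_contDiff (c : ℝ) (p q r : ℕ) : ContDiff ℝ (⊤ : ℕ∞) (mono3 c p q r) := by
  unfold mono3; fun_prop

lemma pdS_mono3_0 (c : ℝ) (p q r : ℕ) : pdS 0 (mono3 c p q r) = mono3 (c * p) (p-1) q r := by
  ext x
  have h : HasFDerivAt (mono3 c p q r) _ x :=
    ((((proj_hasFDerivAt 0 x).pow p).fun_mul ((proj_hasFDerivAt 1 x).pow q)).fun_mul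
      ((proj_hasFDerivAt 2 x).pow r)).const_mul c
  simp [pdS, h.fderiv, mono3]
  ring

lemma pdS_mono3_1 (c : ℝ) (p q r : ℕ) : pdS 1 (mono3 c p q r) = mono3 (c * q) p (q-1) r := by
  ext x
  have h : HasFDerivAt (mono3 c p q r) _ x :=
    ((((proj_hasFDerivAt 0 x).pow p).fun_mul ((proj_hasFDerivAt 1 x).pow q)).fun_mul
      ((proj_hasFDerivAt 2 x).pow r)).const_mul c
  simp [pdS, h.fderiv, mono3]
  ring

lemma pdS_mono3_2 (c : ℝ) (p q r : ℕ) : pdS 2 (mono3 c p q r) = mono3 (c * r) p q (r-1) := by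
  ext x
  have h : HasFDerivAt (mono3 c p q r) _ x :=
    ((((proj_hasFDerivAt 0 x).pow p).fun_mul ((proj_hasFDerivAt 1 x).pow q)).fun_mul
      ((proj_hasFDerivAt 2 x).pow r)).const_mul c
  simp [pdS, h.fderiv, mono3]
  ring

lemma main_poly (A : (Fin 3 → ℕ) → ℝ) (m : Fin 3 → ℕ) (hm : m 0 + m 1 + m 2 = 3) :
    mpd m (fun y => - y 0 + cub A (y 0) (y 1) (y 2)) 0 = A m := by
  have e : (fun y : V3 => - y 0 + cub A (y 0) (y 1) (y 2)) =
    fun y => mono3 (-1) 1 0 0 y + (mono3 (A ![3,0,0] / 6) 3 0 0 y + (mono3 (A ![2,1,0] / 2) 2 1 0 y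
      + (mono3 (A ![2,0,1] / 2) 2 0 1 y + (mono3 (A ![1,2,0] / 2) 1 2 0 y
      + (mono3 (A ![1,1,1]) 1 1 1 y + (mono3 (A ![1,0,2] / 2) 1 0 2 y
      + (mono3 (A ![0,3,0] / 6) 0 3 0 y + (mono3 (A ![0,2,1] / 2) 0 2 1 y
      + (mono3 (A ![0,1,2] / 2) 0 1 2 y + mono3 (A ![0,0,3] / 6) 0 0 3 y))))))))) := by
    ext y
    simp only [mono3, cub]
    ring
  rw [e]
  have c := mono3_contDiff
  have c10 := (c (A ![0,1,2] / 2) 0 1 2).add (c (A ![0,0,3] / 6) 0 0 3)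
  have c9 := (c (A ![0,2,1] / 2) 0 2 1).add c10
  have c8 := (c (A ![0,3,0] / 6) 0 3 0).add c9
  have c7 := (c (A ![1,0,2] / 2) 1 0 2).add c8
  have c6 := (c (A ![1,1,1]) 1 1 1).add c7
  have c5 := (c (A ![1,2,0] / 2) 1 2 0).add c6
  have c4 := (c (A ![2,0,1] / 2) 2 0 1).add c5
  have c3 := (c (A ![2,1,0] / 2) 2 1 0).add c4
  have c2 := (c (A ![3,0,0] / 6) 3 0 0).add c3
  rw [mpd_add m (c _ _ _ _) c2, mpd_add m (c _ _ _ _) c3, mpd_add m (c _ _ _ _) c4,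
    mpd_add m (c _ _ _ _) c5, mpd_add m (c _ _ _ _) c6, mpd_add m (c _ _ _ _) c7,
    mpd_add m (c _ _ _ _) c8, mpd_add m (c _ _ _ _) c9, mpd_add m (c _ _ _ _) c10,
    mpd_add m (c _ _ _ _) (c _ _ _ _)]
  clear c c10 c9 c8 c7 c6 c5 c4 c3 c2 e
  obtain ⟨p, q, r, rfl⟩ : ∃ p q r, m = ![p, q, r] :=
    ⟨m 0, m 1, m 2, by ext i; fin_cases i <;> rfl⟩
  simp only [Matrix.cons_val_zero, Matrix.cons_val_one, Matrix.cons_val] at hm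
  have hp : p ≤ 3 := by omega
  have hq : q ≤ 3 := by omega
  obtain rfl : r = 3 - p - q := by omega
  interval_cases p <;> interval_cases q <;> first
    | (exfalso; omega)
    | (simp [mpd, pdIter, pdS_mono3_0, pdS_mono3_1, pdS_mono3_2]
       simp [mono3]
       try ring)

lemma pdS_eq (A : (Fin 3 → ℕ) → ℝ) {U : V3 → ℝ} (hU : ContDiff ℝ (⊤ : ℕ∞) U)
    (hE : ∀ y, U y + cub A (U y) (y 1) (y 2) = y 0) (y : V3) (v : V3) :
    fderiv ℝ U y v + (cub0 A (U y) (y 1) (y 2) * fderiv ℝ U y v + cub1 A (U y) (y 1) (y 2) * v 1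
      + cub2 A (U y) (y 1) (y 2) * v 2) = v 0 := by
  have h1 := (hU.differentiable (by simp) y).hasFDerivAt
  have h2 := h1.add (cub_hasFDerivAt A h1 (proj_hasFDerivAt 1 y) (proj_hasFDerivAt 2 y))
  have h3 : HasFDerivAt (fun y : V3 => y 0) _ y := h2.congr_of_eventuallyEq
    (Filter.Eventually.of_forall fun z => (hE z).symm)
  have h4 := DFunLike.congr_fun (h3.unique (proj_hasFDerivAt 0 y)) v
  simpa using h4

/-- Family of stationary solutions of the 3D self-similar Burgers equation
(Proposition A.1 of the paper): given any symmetric 3-tensor of third-order Taylor data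
`A(α)`, `|α| = 3`, whose matrix `M_{jk} = A(e₁ + eⱼ + e_k)` is positive definite, there
is a `C^∞` solution `W̄_A` of the stationary self-similar Burgers equation with
`W̄_A(0) = 0`, `∇W̄_A(0) = (−1,0,0)`, all even-order derivatives at `0` vanishing, and
third-order derivatives at `0` equal to `A`. -/
theorem stationary_selfsimilar_burgers_family
    (A : (Fin 3 → ℕ) → ℝ)
    (hA : (Matrix.of (fun j k : Fin 3 =>
        A (Pi.single 0 1 + Pi.single j 1 + Pi.single k 1))).PosDef) :
    ∃ W : V3 → ℝ, ContDiff ℝ (⊤ : ℕ∞) W ∧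
      (∀ y : V3,
        -(1 / 2) * W y + (3 / 2 * y 0 + W y) * pdS 0 W y
          + 1 / 2 * y 1 * pdS 1 W y + 1 / 2 * y 2 * pdS 2 W y = 0) ∧
      W 0 = 0 ∧ pdS 0 W 0 = -1 ∧ pdS 1 W 0 = 0 ∧ pdS 2 W 0 = 0 ∧
      (∀ m : Fin 3 → ℕ, Even (m 0 + m 1 + m 2) → mpd m W 0 = 0) ∧
      (∀ m : Fin 3 → ℕ, m 0 + m 1 + m 2 = 3 → mpd m W 0 = A m) := by
  have h0 := cub0_nonneg A hA
  obtain ⟨U, hU, hE⟩ := exists_U A h0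
  have hodd : ∀ y, U (-y) = - U y := by
    intro y
    apply (cub_bij A h0 (-(y 1)) (-(y 2))).1
    have a := hE (-y)
    have b := hE y
    simp only [Pi.neg_apply] at a
    simp only [cub_neg]
    linarith
  have hU0 : U 0 = 0 := by
    have := hodd 0
    simp only [neg_zero] at this
    linarith
  have hW : ContDiff ℝ (⊤ : ℕ∞) (fun y => - U y) := hU.neg
  have hpd : ∀ j y, pdS j (fun y => - U y) y = - fderiv ℝ U y (Pi.single j 1) := by
    intro j y
    have h1 := (hU.differentiable (by simp) y).hasFDerivAt
    simp [pdS, h1.fun_neg.fderiv]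
  have hq := pdS_eq A hU hE
  have z0 : cub0 A 0 0 0 = 0 := by simp [cub0]
  have z1 : cub1 A 0 0 0 = 0 := by simp [cub1]
  have z2 : cub2 A 0 0 0 = 0 := by simp [cub2]
  refine ⟨fun y => - U y, hW, ?_, by simp [hU0], ?_, ?_, ?_, ?_, ?_⟩
  · intro y
    rw [hpd, hpd, hpd]
    have q0 := hq y (Pi.single 0 1)
    have q1 := hq y (Pi.single 1 1)
    have q2 := hq y (Pi.single 2 1)
    simp at q0 q1 q2
    have hp := h0 (U y) (y 1) (y 2)
    have he := cub_euler A (U y) (y 1) (y 2)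
    have hy := hE y
    have hne : 1 + cub0 A (U y) (y 1) (y 2) ≠ 0 := by positivity
    apply mul_left_cancel₀ hne
    linear_combination (-(3 / 2 * y 0 - U y)) * q0 - 1/2 * y 1 * q1 - 1/2 * y 2 * q2
      + 1/2 * he + 3/2 * hy
  · have := hq 0 (Pi.single 0 1)
    simp [hU0, z0, z1, z2] at this
    rw [hpd, this]
  · have := hq 0 (Pi.single 1 1)
    simp [hU0, z0, z1, z2] at this
    rw [hpd, this, neg_zero]
  · have := hq 0 (Pi.single 2 1)
    simp [hU0, z0, z1, z2] at this
    rw [hpd, this, neg_zero]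
  · intro m hm
    have h1 : ∀ y, (fun y => - U y) (-y) = (-1) * (fun y => - U y) y := by
      intro y
      simp [hodd]
    have h2 := pdIter_neg_symm 0 (m 0) (pdIter_neg_symm 1 (m 1) (pdIter_neg_symm 2 (m 2)
      (f := fun y => - U y) h1)) 0
    rw [neg_zero] at h2
    have h3 : (-1 : ℝ)^(m 0) * ((-1)^(m 1) * ((-1)^(m 2) * (-1))) = -1 := by
      have := hm.neg_one_pow (α := ℝ)
      rw [pow_add, pow_add] at this
      linear_combination (-1) * this
    rw [h3] at h2
    unfold mpd
    linarith
  · intro m hm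
    have p0 : Van 1 (fun y : V3 => y 0) := Van.one (proj_contDiff 0) rfl
    have p1 : Van 1 (fun y : V3 => y 1) := Van.one (proj_contDiff 1) rfl
    have p2 : Van 1 (fun y : V3 => y 2) := Van.one (proj_contDiff 2) rfl
    have pU : Van 1 U := Van.one hU hU0
    have d3 : Van 3 (fun y => U y - y 0) := by
      convert (Van.cub A pU p1 p2).cmul (-1) using 2 with y
      linarith [hE y]
    have hQ : Van 1 (fun y : V3 => A ![3,0,0] / 6 * (U y * U y + U y * y 0 + y 0 * y 0)
        + (A ![2,1,0] / 2 * y 1 + A ![2,0,1] / 2 * y 2) * (U y + y 0)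
        + (A ![1,2,0] / 2 * (y 1)^2 + A ![1,1,1] * (y 1 * y 2) + A ![1,0,2] / 2 * (y 2)^2)) := by
      refine Van.one (by fun_prop) (by simp [hU0])
    have hR : Van 4 (fun y => cub A (U y) (y 1) (y 2) - cub A (y 0) (y 1) (y 2)) := by
      convert Van.mul (n := 4) (a := 3) (b := 1) rfl d3 hQ using 2 with y
      exact cub_sub A _ _ _ _
    have e : (fun y => - U y) = fun y => (- y 0 + cub A (y 0) (y 1) (y 2))
        + (cub A (U y) (y 1) (y 2) - cub A (y 0) (y 1) (y 2)) := by
      ext y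
      linarith [hE y]
    rw [e, mpd_add m ((proj_contDiff 0).neg.add
      (cub_contDiff A (proj_contDiff 0) (proj_contDiff 1) (proj_contDiff 2))) hR.smooth]
    have hR' := Van.mpd m (by rw [hm]; exact hR)
    have := main_poly A m hm
    simp only [this, hR', add_zero]
end
end

section
/- Tailored interpolation inequality (Lemma A.3 of the paper): Let k ≥ 4 be an integer and 0 ≤ l ≤ k−3 an integer. Set q = 6(2k−3)/(2k−1), p = 2q(k−3)/( 2(k−3) + (q−4)l ), a = ( 1/q − 1/p + l/3 ) / ( 1/q − 1/2 + (k−2)/3 ), and b = ( 1/q − (p−2)/(2p) + (k−3−l)/3 ) / ( 1/q − 1/2 + (k−2)/3 ); then a + b = 1 − 1/(2k−4) ∈ (0,1), and there exists a constant C = C(k,l) such that for all compactly supported C^∞ functions φ, ψ : ℝ³ → ℝ: ‖ |D^{2+l}φ| · |D^{k−1−l}ψ| ‖_{L²(ℝ³)} ≤ C ‖D^kφ‖_{L²(ℝ³)}^a ‖D^kψ‖_{L²(ℝ³)}^b ‖D²φ‖_{L^q(ℝ³)}^{1−a} ‖D²ψ‖_{L^q(ℝ³)}^{1−b}. -/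
noncomputable section

open MeasureTheory ENNReal

namespace TI

abbrev E3 := EuclideanSpace ℝ (Fin 3)

/-- L^{1/t} norm -/
def Nrm (f : E3 → ℝ≥0∞) (t : ℝ) : ℝ≥0∞ := (∫⁻ x, f x ^ (1 / t)) ^ t

lemma nrm_rpow (f : E3 → ℝ≥0∞) {t c : ℝ} (hc : c ≠ 0) :
    Nrm (fun x => f x ^ c) (t * c) = (Nrm f t) ^ c := by
  unfold Nrm
  rw [← ENNReal.rpow_mul]
  congr 2
  ext x
  rw [← ENNReal.rpow_mul]
  congr 1
  rw [mul_comm t c, one_div, mul_inv, mul_inv_cancel_left₀ hc, one_div]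

lemma nrm_mono {f g : E3 → ℝ≥0∞} {t : ℝ} (ht : 0 < t) (h : ∀ x, f x ≤ g x) :
    Nrm f t ≤ Nrm g t := by
  unfold Nrm
  gcongr with x
  exact h x

lemma nrm_mul {f g : E3 → ℝ≥0∞} (hf : Measurable f) (hg : Measurable g) {s t : ℝ}
    (hs : 0 < s) (ht : 0 < t) :
    Nrm (fun x => f x * g x) (s + t) ≤ Nrm f s * Nrm g t := by
  have h := ENNReal.lintegral_mul_norm_pow_le (μ := (volume : Measure E3))
    (f := fun x => f x ^ (1 / s)) (g := fun x => g x ^ (1 / t))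
    (hf.pow_const _).aemeasurable (hg.pow_const _).aemeasurable (p := s / (s + t)) (q := t / (s + t))
    (by positivity) (by positivity) (by field_simp)
  have h2 := ENNReal.rpow_le_rpow h (z := s + t) (by positivity)
  rw [ENNReal.mul_rpow_of_nonneg _ _ (by positivity), ← ENNReal.rpow_mul, ← ENNReal.rpow_mul,
    div_mul_cancel₀ _ (by positivity), div_mul_cancel₀ _ (by positivity)] at h2
  refine le_trans (le_of_eq ?_) h2
  unfold Nrm
  congr 2
  ext x
  rw [← ENNReal.rpow_mul, ← ENNReal.rpow_mul, ENNReal.mul_rpow_of_nonneg _ _ (by positivity)]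
  congr 2 <;> field_simp

lemma nrm_sum {ι : Type*} (s : Finset ι) {f : ι → E3 → ℝ≥0∞} (hf : ∀ i, Measurable (f i)) {t : ℝ}
    (ht : 0 < t) (ht1 : t ≤ 1) :
    Nrm (fun x => ∑ i ∈ s, f i x) t ≤ ∑ i ∈ s, Nrm (f i) t := by
  classical
  induction s using Finset.induction with
  | empty => simp [Nrm, ht]
  | insert a s ha ih =>
    simp only [Finset.sum_insert ha]
    refine le_trans ?_ (add_le_add le_rfl ih)
    have := ENNReal.lintegral_Lp_add_le (μ := (volume : Measure E3)) (hf a).aemeasurable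
      (Finset.measurable_sum s (fun i _ => hf i)).aemeasurable (p := 1 / t)
      (by rw [le_div_iff₀ ht]; linarith)
    simpa [Nrm] using this

lemma hasDerivAt_h {s : ℝ} (hs : 2 < s) (w : ℝ) :
    HasDerivAt (fun w : ℝ => |w| ^ (s - 2) * w) ((s - 1) * |w| ^ (s - 2)) w := by
  rcases eq_or_ne w 0 with rfl | hw
  · have : s - 2 ≠ 0 := by linarith
    rw [abs_zero, Real.zero_rpow this, mul_zero, hasDerivAt_iff_tendsto_slope]
    have h1 : Filter.Tendsto (fun w : ℝ => |w| ^ (s - 2)) (nhdsWithin 0 {0}ᶜ) (nhds 0) := by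
      have : Continuous (fun w : ℝ => |w| ^ (s - 2)) :=
        continuous_abs.rpow_const (fun _ => Or.inr (by linarith))
      have h2 := this.tendsto 0
      simp only [abs_zero, Real.zero_rpow ‹s - 2 ≠ 0›] at h2
      exact h2.mono_left nhdsWithin_le_nhds
    refine h1.congr' ?_
    filter_upwards [self_mem_nhdsWithin] with x hx
    have hx : x ≠ 0 := hx
    simp [slope_def_field]
    field_simp
  · have h1 : HasDerivAt (fun w : ℝ => |w| ^ (s - 2))
        (SignType.sign w * (s - 2) * |w| ^ (s - 2 - 1)) w :=
      (hasDerivAt_abs hw).rpow_const (Or.inl (abs_ne_zero.2 hw))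
    refine (h1.mul (hasDerivAt_id w)).congr_deriv ?_
    have h2 : |w| ^ (s - 2) = |w| ^ (s - 2 - 1) * |w| := by
      rw [Real.rpow_sub_one (abs_ne_zero.2 hw)]; field_simp
    have h3 : (SignType.sign w : ℝ) * w = |w| := by simp
    simp only [id]
    rw [h2]
    linear_combination (s - 2) * |w| ^ (s - 2 - 1) * h3

lemma step_scalar {f : E3 → ℝ} (hf : ContDiff ℝ 2 f) (hc : HasCompactSupport f) (e : E3)
    {s : ℝ} (hs : 2 < s) :
    ∫⁻ x, ‖fderiv ℝ f x e‖ₑ ^ s ≤ ENNReal.ofReal (s - 1) * ∫⁻ x, ‖f x‖ₑ *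
      (‖fderiv ℝ f x e‖ₑ ^ (s - 2) * ‖fderiv ℝ (fun y => fderiv ℝ f y e) x e‖ₑ) := by
  set w : E3 → ℝ := fun y => fderiv ℝ f y e with hw
  have hwC : ContDiff ℝ 1 w := (hf.fderiv_right (m := 1) (by norm_num)).clm_apply contDiff_const
  have hwc : HasCompactSupport w := hc.fderiv_apply (𝕜 := ℝ) e
  have hcont : Continuous (fun w : ℝ => |w| ^ (s - 2)) :=
        continuous_abs.rpow_const (fun _ => Or.inr (by linarith))
  have hfd : ∀ x, HasFDerivAt (fun y => |w y| ^ (s - 2) * w y)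
      (((s - 1) * |w x| ^ (s - 2)) • fderiv ℝ w x) x := fun x =>
    (hasDerivAt_h hs (w x)).comp_hasFDerivAt x
      ((hwC.differentiable (by norm_num)) x).hasFDerivAt
  have hgc : Continuous (fun x => fderiv ℝ w x e) :=
    (hwC.continuous_fderiv (by norm_num)).clm_apply continuous_const
  have ibp := integral_mul_fderiv_eq_neg_fderiv_mul_of_integrable (μ := (volume : Measure E3))
    (f := fun y => |w y| ^ (s - 2) * w y) (g := f) (v := e) ?_ ?_ ?_
    (fun x _ => (hfd x).differentiableAt) (fun x _ => (hf.differentiable (by norm_num)) x)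
  rotate_left
  · simp only [(hfd _).fderiv]
    refine Continuous.integrable_of_hasCompactSupport ?_ ?_
    · simp only [_root_.smul_apply, smul_eq_mul]
      exact ((continuous_const.mul (hcont.comp hwC.continuous)).mul hgc).mul hf.continuous
    · exact hc.mul_left
  · refine Continuous.integrable_of_hasCompactSupport ?_ ?_
    · exact ((hcont.comp hwC.continuous).mul hwC.continuous).mul hwC.continuous
    · exact hwc.mul_left
  · refine Continuous.integrable_of_hasCompactSupport ?_ ?_
    · exact ((hcont.comp hwC.continuous).mul hwC.continuous).mul hf.continuous
    · exact hc.mul_left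
  have hint : Integrable (fun x => |w x| ^ (s - 2) * w x * w x) volume := by
    refine Continuous.integrable_of_hasCompactSupport ?_ ?_
    · exact ((hcont.comp hwC.continuous).mul hwC.continuous).mul hwC.continuous
    · exact hwc.mul_left
  have hnn : ∀ x, 0 ≤ |w x| ^ (s - 2) * w x * w x := fun x => by
    rw [mul_assoc]; exact mul_nonneg (by positivity) (mul_self_nonneg _)
  have e1 : ∫⁻ x, ‖w x‖ₑ ^ s = ENNReal.ofReal (∫ x, |w x| ^ (s - 2) * w x * w x) := by
    rw [ofReal_integral_eq_lintegral_ofReal hint (Filter.Eventually.of_forall hnn)]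
    congr 1; ext x
    rw [Real.enorm_eq_ofReal_abs, ENNReal.ofReal_rpow_of_nonneg (abs_nonneg _) (by linarith)]
    congr 1
    rw [mul_assoc, ← abs_mul_abs_self (w x), ← mul_assoc]
    rcases eq_or_ne (w x) 0 with h0 | h0
    · rw [h0]; simp; rw [Real.zero_rpow (by linarith)]
    · rw [Real.rpow_sub (by positivity)]
      have : |w x| ≠ 0 := by positivity
      norm_num
      field_simp
      simp
  rw [e1, ibp, ← lintegral_const_mul' _ _ ENNReal.ofReal_ne_top]
  refine le_trans (Real.ofReal_le_enorm _) ?_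
  rw [enorm_neg]
  refine le_trans (enorm_integral_le_lintegral_enorm _) (le_of_eq ?_)
  congr 1; ext x
  rw [(hfd x).fderiv]
  simp only [_root_.smul_apply, smul_eq_mul, enorm_mul]
  rw [Real.enorm_eq_ofReal (by linarith : 0 ≤ s - 1),
    Real.enorm_eq_ofReal (by positivity : 0 ≤ |w x| ^ (s - 2)),
    ← ENNReal.ofReal_rpow_of_nonneg (abs_nonneg _) (by linarith), ← Real.enorm_eq_ofReal_abs]
  ring

lemma cvx1 (C : ℕ → ℝ≥0∞) (hC : ∀ i, C i ≠ ⊤) (j : ℕ) : ∃ D : ℝ≥0∞, D ≠ ⊤ ∧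
    ∀ X : ℕ → ℝ≥0∞, (∀ i, X i ≠ ⊤) →
      (∀ i, i + 1 ≤ j → X (i + 1) ^ 2 ≤ C i * X i * X (i + 2)) →
      X j ^ (j + 1) ≤ D * X 0 * X (j + 1) ^ j := by
  induction j with
  | zero => exact ⟨1, by simp, fun X _ _ => by simp⟩
  | succ j ih =>
    obtain ⟨D, hD, h⟩ := ih
    refine ⟨C j ^ (j + 1) * D, ENNReal.mul_ne_top (ENNReal.pow_ne_top (hC j)) hD,
      fun X hX hc => ?_⟩
    have h1 := h X hX (fun i hi => hc i (by omega))
    have h2 := hc j le_rfl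
    by_cases h0 : X (j + 1) = 0
    · rw [h0]; simp
    have h3 : X (j + 1) ^ j * X (j + 1) ^ (j + 1 + 1) ≤
        X (j + 1) ^ j * (C j ^ (j + 1) * D * X 0 * X (j + 1 + 1) ^ (j + 1)) := by
      calc X (j + 1) ^ j * X (j + 1) ^ (j + 1 + 1) = (X (j + 1) ^ 2) ^ (j + 1) := by ring
        _ ≤ (C j * X j * X (j + 2)) ^ (j + 1) := by gcongr
        _ = C j ^ (j + 1) * X j ^ (j + 1) * X (j + 2) ^ (j + 1) := by ring
        _ ≤ C j ^ (j + 1) * (D * X 0 * X (j + 1) ^ j) * X (j + 2) ^ (j + 1) := by gcongr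
        _ = _ := by ring
    exact (ENNReal.mul_le_mul_iff_right (pow_ne_zero _ h0) (ENNReal.pow_ne_top (hX _))).1 h3

lemma cvx (C : ℕ → ℝ≥0∞) (hC : ∀ i, C i ≠ ⊤) (n j : ℕ) (hj : j ≤ n) :
    ∃ D : ℝ≥0∞, D ≠ ⊤ ∧
    ∀ X : ℕ → ℝ≥0∞, (∀ i, X i ≠ ⊤) →
      (∀ i, i + 2 ≤ n → X (i + 1) ^ 2 ≤ C i * X i * X (i + 2)) →
      X j ≤ D * X 0 ^ (1 - (j : ℝ) / n) * X n ^ ((j : ℝ) / n) := by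
  rcases Nat.eq_zero_or_pos j with rfl | hj0
  · exact ⟨1, by simp, fun X _ _ => by simp⟩
  induction n, hj using Nat.le_induction with
  | base =>
    refine ⟨1, by simp, fun X _ _ => ?_⟩
    have : (j : ℝ) ≠ 0 := by positivity
    simp [div_self this]
  | succ n hjn ih =>
    obtain ⟨D, hD, h⟩ := ih
    obtain ⟨D', hD', h'⟩ := cvx1 C hC n
    have hn0 : (0 : ℝ) < n := by exact_mod_cast (by omega : 0 < n)
    have hjn' : (j : ℝ) ≤ n := by exact_mod_cast hjn
    refine ⟨D * (D' ^ (1 / ((n : ℝ) + 1))) ^ ((j : ℝ) / n), ENNReal.mul_ne_top hD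
      (ENNReal.rpow_ne_top_of_nonneg (by positivity) (ENNReal.rpow_ne_top_of_nonneg (by positivity) hD')),
      fun X hX hc => ?_⟩
    have h1 := h X hX (fun i hi => hc i (by omega))
    have h2 := h' X hX (fun i hi => hc i (by omega))
    have h3 : X n ≤ D' ^ (1 / ((n : ℝ) + 1)) * X 0 ^ (1 / ((n : ℝ) + 1)) *
        X (n + 1) ^ ((n : ℝ) / (n + 1)) := by
      have h4 := ENNReal.rpow_le_rpow h2 (z := 1 / ((n : ℝ) + 1)) (by positivity)
      rw [ENNReal.mul_rpow_of_nonneg _ _ (by positivity),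
        ENNReal.mul_rpow_of_nonneg _ _ (by positivity), ← ENNReal.rpow_natCast,
        ← ENNReal.rpow_natCast, ← ENNReal.rpow_mul, ← ENNReal.rpow_mul] at h4
      convert h4 using 2
      · push_cast
        rw [mul_one_div_cancel (by positivity), ENNReal.rpow_one]
      · rw [mul_one_div]
    have hs : 0 ≤ 1 - (j : ℝ) / n := by rw [sub_nonneg, div_le_one hn0]; exact hjn'
    calc X j ≤ D * X 0 ^ (1 - (j : ℝ) / n) * X n ^ ((j : ℝ) / n) := h1
      _ ≤ D * X 0 ^ (1 - (j : ℝ) / n) * (D' ^ (1 / ((n : ℝ) + 1)) * X 0 ^ (1 / ((n : ℝ) + 1)) *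
        X (n + 1) ^ ((n : ℝ) / (n + 1))) ^ ((j : ℝ) / n) := by gcongr
      _ = D * (D' ^ (1 / ((n : ℝ) + 1))) ^ ((j : ℝ) / n) *
          (X 0 ^ (1 - (j : ℝ) / n) * X 0 ^ (1 / ((n : ℝ) + 1) * ((j : ℝ) / n))) *
          X (n + 1) ^ ((n : ℝ) / (n + 1) * ((j : ℝ) / n)) := by
        rw [ENNReal.mul_rpow_of_nonneg _ _ (by positivity),
          ENNReal.mul_rpow_of_nonneg _ _ (by positivity), ← ENNReal.rpow_mul (X 0),
          ← ENNReal.rpow_mul (X (n + 1))]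
        ring
      _ = _ := by
        rw [← ENNReal.rpow_add_of_nonneg _ _ hs (by positivity)]
        congr 2
        · congr 1
          push_cast; field_simp; ring
        · push_cast; field_simp

lemma nrm_eq {F : Type*} [NormedAddCommGroup F] (f : E3 → F) {t : ℝ} (ht : 0 < t) :
    eLpNorm f (ENNReal.ofReal (1 / t)) volume = Nrm (fun x => ‖f x‖ₑ) t := by
  rw [eLpNorm_eq_lintegral_rpow_enorm_toReal (by simpa using ht) ENNReal.ofReal_ne_top,
    ENNReal.toReal_ofReal (by positivity), Nrm, one_div_one_div]

lemma nrm_ne_top {F : Type*} [NormedAddCommGroup F] (f : E3 → F)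
    (hf : Continuous f) (hc : HasCompactSupport f) {t : ℝ} (ht : 0 < t) :
    Nrm (fun x => ‖f x‖ₑ) t ≠ ⊤ := by
  rw [← nrm_eq f ht]
  exact (hf.memLp_of_hasCompactSupport hc).eLpNorm_ne_top

lemma step_scalar' {f : E3 → ℝ} (hf : ContDiff ℝ 2 f) (hc : HasCompactSupport f) (e : E3)
    {t t0 t2 : ℝ} (h0 : 0 < t0) (h2 : 0 < t2) (ht : t < 1 / 2) (htt : 2 * t = t0 + t2) :
    Nrm (fun x => ‖fderiv ℝ f x e‖ₑ) t ^ 2 ≤ ENNReal.ofReal (1 / t - 1) *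
      Nrm (fun x => ‖f x‖ₑ) t0 * Nrm (fun x => ‖fderiv ℝ (fun y => fderiv ℝ f y e) x e‖ₑ) t2 := by
  have hwC : ContDiff ℝ 1 (fun y => fderiv ℝ f y e) :=
    (hf.fderiv_right (m := 1) (by norm_num)).clm_apply contDiff_const
  have hwc : HasCompactSupport (fun y => fderiv ℝ f y e) := hc.fderiv_apply (𝕜 := ℝ) e
  have hgc : Continuous (fun x => fderiv ℝ (fun y => fderiv ℝ f y e) x e) :=
    (hwC.continuous_fderiv (by norm_num)).clm_apply continuous_const
  have ht0 : 0 < t := by linarith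
  have hs : 2 < 1 / t := by rw [lt_div_iff₀ ht0]; linarith
  have h := step_scalar hf hc e hs
  set w : E3 → ℝ := fun y => fderiv ℝ f y e with hw
  have hwm : Measurable (fun x => ‖w x‖ₑ) := hwC.continuous.enorm.measurable
  have hgm : Measurable (fun x => ‖fderiv ℝ w x e‖ₑ) := hgc.enorm.measurable
  have hfm : Measurable (fun x => ‖f x‖ₑ) := hf.continuous.enorm.measurable
  have hp : 0 < t * (1 / t - 2) := mul_pos ht0 (by linarith)
  have k1 := nrm_mul hfm ((hwm.pow_const (1 / t - 2)).mul hgm) h0 (add_pos hp h2)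
  have k2 := nrm_mul (hwm.pow_const (1 / t - 2)) hgm hp h2
  rw [nrm_rpow _ (by linarith)] at k2
  have hone : t0 + (t * (1 / t - 2) + t2) = 1 := by
    have : t * (1 / t - 2) = 1 - 2 * t := by field_simp
    rw [this]; linarith
  rw [hone] at k1
  set A := Nrm (fun x => ‖w x‖ₑ) t with hA
  have hAt : A ≠ ⊤ := nrm_ne_top w hwC.continuous hwc ht0
  have hAs : A ^ (1 / t) = ∫⁻ x, ‖w x‖ₑ ^ (1 / t) := by
    rw [hA, Nrm, ← ENNReal.rpow_mul, mul_one_div_cancel ht0.ne', ENNReal.rpow_one]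
  have k3 : A ^ (1 / t) ≤ ENNReal.ofReal (1 / t - 1) * (Nrm (fun x => ‖f x‖ₑ) t0 *
      (A ^ (1 / t - 2) * Nrm (fun x => ‖fderiv ℝ w x e‖ₑ) t2)) := by
    rw [hAs]
    refine h.trans ?_
    gcongr
    refine le_trans (le_of_eq ?_) (k1.trans ?_)
    · simp [Nrm, hw]
    · gcongr
      exact k2
  by_cases hA0 : A = 0
  · simp [hA0]
  have hAe : A ^ (1 / t) = A ^ (1 / t - 2) * A ^ 2 := by
    rw [← ENNReal.rpow_natCast A 2, ← ENNReal.rpow_add _ _ hA0 hAt]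
    congr 1; push_cast; ring
  rw [hAe] at k3
  refine (ENNReal.mul_le_mul_iff_right (a := A ^ (1 / t - 2)) ?_ ?_).1 (k3.trans (le_of_eq ?_))
  · exact (ENNReal.rpow_pos (pos_iff_ne_zero.2 hA0) hAt).ne'
  · exact ENNReal.rpow_ne_top_of_nonneg (by linarith) hAt
  · ring

/-- L^{1/t} norm of the j-th derivative -/
def N (φ : E3 → ℝ) (j : ℕ) (t : ℝ) : ℝ≥0∞ := Nrm (fun x => ‖iteratedFDeriv ℝ j φ x‖ₑ) t

def bv (i : Fin 3) : E3 := EuclideanSpace.single i 1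

lemma norm_bv (i : Fin 3) : ‖bv i‖ = 1 := by simp [bv]

lemma cmm_bound {j : ℕ} (M : ContinuousMultilinearMap ℝ (fun _ : Fin j => E3) ℝ) :
    ‖M‖ ≤ ∑ I : Fin j → Fin 3, ‖M (fun i => bv (I i))‖ := by
  refine M.opNorm_le_bound (Finset.sum_nonneg fun _ _ => norm_nonneg _) fun v => ?_
  have hv : v = fun i => ∑ c : Fin 3, (v i c) • bv c := by
    ext i c
    fin_cases c <;> simp [bv, Fin.sum_univ_three]
  conv_lhs => rw [hv, M.map_sum]
  refine (norm_sum_le _ _).trans ?_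
  rw [Finset.sum_mul]
  refine Finset.sum_le_sum fun I _ => ?_
  rw [M.map_smul_univ, norm_smul, mul_comm, norm_prod]
  gcongr with i
  exact PiLp.norm_apply_le _ _

lemma cmm_le {j : ℕ} (M : ContinuousMultilinearMap ℝ (fun _ : Fin j => E3) ℝ)
    (I : Fin j → Fin 3) : ‖M (fun i => bv (I i))‖ₑ ≤ ‖M‖ₑ := by
  rw [enorm_le_iff_norm_le]
  refine (M.le_opNorm _).trans ?_
  simp [norm_bv]

section
variable {φ : E3 → ℝ} (hφ : ContDiff ℝ (⊤ : ℕ∞) φ) (hc : HasCompactSupport φ)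
include hφ

lemma contDiff_itd (j : ℕ) : ContDiff ℝ (⊤ : ℕ∞) (iteratedFDeriv ℝ j φ) :=
  hφ.iteratedFDeriv_right (by exact_mod_cast le_top)

lemma contDiff_comp (j : ℕ) (m : Fin j → E3) :
    ContDiff ℝ (⊤ : ℕ∞) (fun x => iteratedFDeriv ℝ j φ x m) :=
  (ContinuousMultilinearMap.apply ℝ (fun _ : Fin j => E3) ℝ m).contDiff.comp (contDiff_itd hφ j)

lemma fderiv_comp' (j : ℕ) (m : Fin j → E3) (e x : E3) :
    fderiv ℝ (fun x => iteratedFDeriv ℝ j φ x m) x e =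
      iteratedFDeriv ℝ (j + 1) φ x (Fin.cons e m : Fin (j + 1) → E3) := by
  have h1 : HasFDerivAt (iteratedFDeriv ℝ j φ) (fderiv ℝ (iteratedFDeriv ℝ j φ) x) x :=
    (((contDiff_itd hφ j).differentiable (by simp)) x).hasFDerivAt
  have h2 := (ContinuousMultilinearMap.apply ℝ (fun _ : Fin j => E3) ℝ m).hasFDerivAt.comp x h1
  have h3 : fderiv ℝ (fun x => iteratedFDeriv ℝ j φ x m) x = _ := h2.fderiv
  rw [h3, iteratedFDeriv_succ_apply_left]
  simp

lemma N_le_sum (j : ℕ) {t : ℝ} (ht : 0 < t) (ht1 : t ≤ 1) :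
    N φ j t ≤ ∑ I : Fin j → Fin 3,
      Nrm (fun x => ‖iteratedFDeriv ℝ j φ x (fun i => bv (I i))‖ₑ) t := by
  refine le_trans (nrm_mono ht (fun x => ?_)) (nrm_sum _ (fun I => ?_) ht ht1)
  · have := cmm_bound (iteratedFDeriv ℝ j φ x)
    rw [← ofReal_norm]
    refine (ENNReal.ofReal_le_ofReal this).trans (le_of_eq ?_)
    rw [ENNReal.ofReal_sum_of_nonneg (fun _ _ => norm_nonneg _)]
    simp only [ofReal_norm]
  · exact (contDiff_comp hφ j _).continuous.enorm.measurable

include hc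

lemma hcs_comp (j : ℕ) (m : Fin j → E3) :
    HasCompactSupport (fun x => iteratedFDeriv ℝ j φ x m) :=
  (hc.iteratedFDeriv (𝕜 := ℝ) j).comp_left (g := fun M : ContinuousMultilinearMap ℝ (fun _ : Fin j => E3) ℝ => M m) rfl

lemma N_ne_top (j : ℕ) {t : ℝ} (ht : 0 < t) : N φ j t ≠ ⊤ :=
  nrm_ne_top _ (contDiff_itd hφ j).continuous (hc.iteratedFDeriv j) ht

lemma step_N (j : ℕ) {t t0 t2 : ℝ} (h0 : 0 < t0) (h2 : 0 < t2) (ht : t < 1 / 2)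
    (htt : 2 * t = t0 + t2) :
    N φ (j + 1) t ^ 2 ≤ ((3 ^ (j + 1)) ^ 2 * ENNReal.ofReal (1 / t - 1)) *
      N φ j t0 * N φ (j + 2) t2 := by
  have ht0 : 0 < t := by linarith
  have hI : ∀ I : Fin (j + 1) → Fin 3,
      Nrm (fun x => ‖iteratedFDeriv ℝ (j + 1) φ x (fun i => bv (I i))‖ₑ) t ≤
      (ENNReal.ofReal (1 / t - 1) * N φ j t0 * N φ (j + 2) t2) ^ (1 / 2 : ℝ) := by
    intro I
    have h := step_scalar' ((contDiff_comp hφ j (fun i => bv (I i.succ))).of_le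
      (WithTop.coe_le_coe.2 (le_top : (2 : ℕ∞) ≤ ⊤))) (hcs_comp hφ hc j _) (bv (I 0)) h0 h2 ht htt
    simp only [fderiv_comp' hφ] at h
    have e1 : (Fin.cons (bv (I 0)) (fun i : Fin j => bv (I i.succ)) : Fin (j + 1) → E3) =
        fun i => bv (I i) := by
      ext i : 1
      refine Fin.cases ?_ (fun i => ?_) i <;> simp
    have e2 : (Fin.cons (bv (I 0)) (fun i : Fin (j + 1) => bv (I i)) : Fin (j + 2) → E3) =
        fun i => bv ((Fin.cons (I 0) I : Fin (j + 2) → Fin 3) i) := by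
      ext i : 1
      refine Fin.cases ?_ (fun i => ?_) i <;> simp
    rw [e1, e2] at h
    have h' := ENNReal.rpow_le_rpow h (z := 1 / 2) (by norm_num)
    rw [← ENNReal.rpow_natCast, ← ENNReal.rpow_mul] at h'
    norm_num at h'
    refine h'.trans ?_
    norm_num
    gcongr
    · exact nrm_mono h0 fun x => cmm_le _ (fun i => I i.succ)
    · exact nrm_mono h2 fun x => cmm_le _ _
  have h3 := (N_le_sum hφ (j + 1) ht0 (by linarith)).trans (Finset.sum_le_sum fun I _ => hI I)
  rw [Finset.sum_const, nsmul_eq_mul] at h3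
  simp only [Finset.card_univ, Fintype.card_fun, Fintype.card_fin] at h3
  calc N φ (j + 1) t ^ 2 ≤ _ := pow_le_pow_left' h3 2
    _ = _ := by
      rw [mul_pow, ← ENNReal.rpow_natCast (_ ^ (1 / 2 : ℝ)), ← ENNReal.rpow_mul]
      norm_num
      ring

lemma sob_N (j : ℕ) :
    N φ j (1 / 6) ≤ (3 ^ j * eLpNormLESNormFDerivOfEqInnerConst (volume : Measure E3) 2) *
      N φ (j + 1) (1 / 2) := by
  have hI : ∀ I : Fin j → Fin 3,
      Nrm (fun x => ‖iteratedFDeriv ℝ j φ x (fun i => bv (I i))‖ₑ) (1 / 6) ≤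
      eLpNormLESNormFDerivOfEqInnerConst (volume : Measure E3) 2 * N φ (j + 1) (1 / 2) := by
    intro I
    have h := eLpNorm_le_eLpNorm_fderiv_of_eq_inner (volume : Measure E3)
      ((contDiff_comp hφ j (fun i => bv (I i))).of_le (by exact_mod_cast le_top))
      (hcs_comp hφ hc j _) (p := 2) (p' := 6) (by norm_num) (by simp) (by simp; norm_num)
    rw [← nrm_eq _ (by norm_num)]
    norm_num at h ⊢
    refine h.trans ?_
    gcongr
    have e := nrm_eq (iteratedFDeriv ℝ (j + 1) φ) (t := 1 / 2) (by norm_num)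
    norm_num at e
    rw [N]
    norm_num
    rw [← e]
    refine eLpNorm_mono fun x => ?_
    rw [← norm_fderiv_iteratedFDeriv]
    have h1 : HasFDerivAt (iteratedFDeriv ℝ j φ) (fderiv ℝ (iteratedFDeriv ℝ j φ) x) x :=
      (((contDiff_itd hφ j).differentiable (by simp)) x).hasFDerivAt
    have h2 := (ContinuousMultilinearMap.apply ℝ (fun _ : Fin j => E3) ℝ
      (fun i => bv (I i))).hasFDerivAt.comp x h1
    have h3 : fderiv ℝ (fun x => iteratedFDeriv ℝ j φ x (fun i => bv (I i))) x = _ := h2.fderiv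
    rw [h3]
    refine ContinuousLinearMap.opNorm_le_bound _ (by positivity) fun v => ?_
    refine le_trans ?_ (ContinuousLinearMap.le_opNorm _ v)
    have := cmm_le (fderiv ℝ (iteratedFDeriv ℝ j φ) x v) I
    rw [enorm_le_iff_norm_le] at this
    exact this
  have h3 := (N_le_sum hφ j (by norm_num) (by norm_num)).trans (Finset.sum_le_sum fun I _ => hI I)
  rw [Finset.sum_const, nsmul_eq_mul] at h3
  simp only [Finset.card_univ, Fintype.card_fun, Fintype.card_fin] at h3
  refine h3.trans (le_of_eq ?_)
  push_cast
  ring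

lemma interp_N (j : ℕ) {s t : ℝ} (hs : 0 < s) (ht : 0 < t) :
    N φ j (s * (1 / 2) + t * (1 / 2)) ≤ N φ j s ^ (1 / 2 : ℝ) * N φ j t ^ (1 / 2 : ℝ) := by
  have hm : Measurable (fun x => ‖iteratedFDeriv ℝ j φ x‖ₑ) :=
    (contDiff_itd hφ j).continuous.enorm.measurable
  have h := nrm_mul (hm.pow_const (1 / 2 : ℝ)) (hm.pow_const (1 / 2 : ℝ)) (s := s * (1 / 2))
    (t := t * (1 / 2)) (by positivity) (by positivity)
  rw [nrm_rpow _ (by norm_num), nrm_rpow _ (by norm_num)] at h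
  refine le_trans (le_of_eq ?_) h
  unfold N
  congr 1
  ext x
  rw [← ENNReal.rpow_add_of_nonneg _ _ (by norm_num) (by norm_num)]
  norm_num

end

lemma chain (t0 t1 : ℝ) (h0 : 0 < t0) (h0' : t0 < 1 / 2) (h1 : 0 < t1) (h1' : t1 ≤ 1 / 2)
    (n j : ℕ) (hn : 1 ≤ n) (hj : j ≤ n) :
    ∃ D : ℝ≥0∞, D ≠ ⊤ ∧ ∀ φ : E3 → ℝ, ContDiff ℝ (⊤ : ℕ∞) φ → HasCompactSupport φ →
      N φ (2 + j) (t0 + (j : ℝ) / n * (t1 - t0)) ≤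
        D * N φ 2 t0 ^ (1 - (j : ℝ) / n) * N φ (2 + n) t1 ^ ((j : ℝ) / n) := by
  set T : ℕ → ℝ := fun i => t0 + (i : ℝ) / n * (t1 - t0) with hT
  have hn0 : (0 : ℝ) < n := by exact_mod_cast hn
  have hTc : ∀ i, T i = (1 - (i : ℝ) / n) * t0 + (i : ℝ) / n * t1 := fun i => by
    simp only [hT]; ring
  have hTpos : ∀ i ≤ n, 0 < T i := fun i hi => by
    have hi1 : (i : ℝ) / n ≤ 1 := by rw [div_le_one hn0]; exact_mod_cast hi
    have hi0 : 0 ≤ (i : ℝ) / n := by positivity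
    rw [hTc]
    rcases hi0.eq_or_lt with h | h
    · rw [← h]; simpa using h0
    · have := mul_nonneg (sub_nonneg.2 hi1) h0.le
      have := mul_pos h h1
      linarith
  have hTlt : ∀ i < n, T i < 1 / 2 := fun i hi => by
    have hi1 : (i : ℝ) / n < 1 := by rw [div_lt_one hn0]; exact_mod_cast hi
    have hi0 : 0 ≤ (i : ℝ) / n := by positivity
    rw [hTc]
    have := mul_lt_mul_of_pos_left h0' (sub_pos.2 hi1)
    have := mul_le_mul_of_nonneg_left h1' hi0
    linarith
  obtain ⟨D, hD, h⟩ := cvx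
    (fun i => (3 ^ (2 + i + 1)) ^ 2 * ENNReal.ofReal (1 / T (i + 1) - 1))
    (fun i => ENNReal.mul_ne_top (by finiteness) ENNReal.ofReal_ne_top) n j hj
  refine ⟨D, hD, fun φ hφ hc => ?_⟩
  have := h (fun i => if i ≤ n then N φ (2 + i) (T i) else 0) (fun i => ?_) (fun i hi => ?_)
  · have e0 : T 0 = t0 := by simp [hT]
    have e1 : T n = t1 := by simp [hT, hn0.ne']
    simpa [hj, e0, e1] using this
  · split_ifs with hi
    · exact N_ne_top hφ hc _ (hTpos i hi)
    · simp
  · simp only [hi, (by omega : i + 1 ≤ n), (by omega : i ≤ n), if_true]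
    refine step_N hφ hc (2 + i) (hTpos i (by omega)) (hTpos (i + 2) hi) (hTlt (i + 1) (by omega)) ?_
    simp only [hT]; push_cast; ring

lemma gn (n l : ℕ) (hn : 1 ≤ n) (hl : l ≤ n) (r : ℝ)
    (hr : r = (2 * (n : ℝ) + 5) / (6 * (2 * n + 3))) :
    ∃ D : ℝ≥0∞, D ≠ ⊤ ∧ ∀ φ : E3 → ℝ, ContDiff ℝ (⊤ : ℕ∞) φ → HasCompactSupport φ →
      N φ (2 + l) (r + (l : ℝ) / n * (1 / 2 - 2 * r)) ≤
        D * N φ (n + 3) (1 / 2) ^ ((l : ℝ) / n * ((2 * n + 1) / (2 * (n + 1))))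
          * N φ 2 r ^ (1 - (l : ℝ) / n * ((2 * n + 1) / (2 * (n + 1)))) := by
  have hn0 : (0 : ℝ) < n := by exact_mod_cast hn
  have hn1 : (1 : ℝ) ≤ n := by exact_mod_cast hn
  have hr0 : 0 < r := by rw [hr]; positivity
  have hr2 : r < 1 / 2 := by rw [hr, div_lt_div_iff₀ (by positivity) (by norm_num)]; linarith
  obtain ⟨D1, hD1, k1⟩ := chain r (1 / 2 - r) hr0 hr2 (by linarith) (by linarith) n l hn hl
  obtain ⟨D2, hD2, k2⟩ := chain r (1 / 2) hr0 hr2 (by norm_num) le_rfl (n + 1) n (by omega) (by omega)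
  set S : ℝ≥0∞ := 3 ^ (2 + n) * eLpNormLESNormFDerivOfEqInnerConst (volume : Measure E3) 2 with hS
  have hSt : S ≠ ⊤ := ENNReal.mul_ne_top (by finiteness) ENNReal.coe_ne_top
  set u : ℝ := (l : ℝ) / n with hu
  have hu0 : 0 ≤ u := by positivity
  have hu1 : u ≤ 1 := by rw [hu, div_le_one hn0]; exact_mod_cast hl
  refine ⟨D1 * (D2 ^ (1 / 2 : ℝ) * S ^ (1 / 2 : ℝ)) ^ u, ?_, fun φ hφ hc => ?_⟩
  · exact ENNReal.mul_ne_top hD1 (ENNReal.rpow_ne_top_of_nonneg hu0 (ENNReal.mul_ne_top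
      (ENNReal.rpow_ne_top_of_nonneg (by norm_num) hD2)
      (ENNReal.rpow_ne_top_of_nonneg (by norm_num) hSt)))
  have j1 := k1 φ hφ hc
  have j2 := k2 φ hφ hc
  have j3 := sob_N hφ hc (2 + n)
  rw [← hS] at j3
  set τ := r + (n : ℝ) / ((n + 1 : ℕ) : ℝ) * (1 / 2 - r) with hτ
  have hτ0 : 0 < τ := by
    have : 0 ≤ (n : ℝ) / ((n + 1 : ℕ) : ℝ) * (1 / 2 - r) := mul_nonneg (by positivity) (by linarith)
    linarith
  have j4 := interp_N hφ hc (2 + n) hτ0 (by norm_num : (0 : ℝ) < 1 / 6)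
  have hτe : τ * (1 / 2) + 1 / 6 * (1 / 2) = 1 / 2 - r := by
    rw [hτ, hr]; push_cast; field_simp; ring
  rw [hτe] at j4
  have e1 : 2 + n + 1 = n + 3 := by omega
  have e2 : 2 + (n + 1) = n + 3 := by omega
  rw [e1] at j3
  rw [e2] at j2
  have e3 : 1 / 2 - r - r = 1 / 2 - 2 * r := by ring
  rw [e3] at j1
  set v : ℝ := (n : ℝ) / ((n + 1 : ℕ) : ℝ) with hv
  have hv0 : 0 ≤ v := by positivity
  have hv1 : v ≤ 1 := by rw [hv, div_le_one (by positivity)]; push_cast; linarith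
  set A := N φ 2 r
  set B := N φ (n + 3) (1 / 2)
  have j5 : N φ (2 + n) (1 / 2 - r) ≤ (D2 ^ (1 / 2 : ℝ) * S ^ (1 / 2 : ℝ)) *
      A ^ ((1 - v) * (1 / 2)) * B ^ (v * (1 / 2) + 1 / 2) := by
    calc _ ≤ _ := j4
      _ ≤ (D2 * A ^ (1 - v) * B ^ v) ^ (1 / 2 : ℝ) * (S * B) ^ (1 / 2 : ℝ) := by gcongr
      _ = _ := by
        rw [ENNReal.mul_rpow_of_nonneg _ _ (by positivity),
          ENNReal.mul_rpow_of_nonneg _ _ (by positivity),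
          ENNReal.mul_rpow_of_nonneg _ _ (by positivity), ← ENNReal.rpow_mul, ← ENNReal.rpow_mul,
          ENNReal.rpow_add_of_nonneg _ _ (by positivity) (by positivity)]
        ring
  have hw : 0 ≤ (1 - v) * (1 / 2) := mul_nonneg (by linarith) (by norm_num)
  calc _ ≤ _ := j1
    _ ≤ D1 * A ^ (1 - u) * ((D2 ^ (1 / 2 : ℝ) * S ^ (1 / 2 : ℝ)) *
      A ^ ((1 - v) * (1 / 2)) * B ^ (v * (1 / 2) + 1 / 2)) ^ u := by gcongr
    _ = D1 * (D2 ^ (1 / 2 : ℝ) * S ^ (1 / 2 : ℝ)) ^ u * B ^ ((v * (1 / 2) + 1 / 2) * u) *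
        (A ^ (1 - u) * A ^ ((1 - v) * (1 / 2) * u)) := by
      rw [ENNReal.mul_rpow_of_nonneg _ _ hu0, ENNReal.mul_rpow_of_nonneg _ (A ^ _) hu0,
        ← ENNReal.rpow_mul, ← ENNReal.rpow_mul]
      ring
    _ = _ := by
      rw [← ENNReal.rpow_add_of_nonneg _ _ (by linarith) (mul_nonneg hw hu0)]
      have h1 : (v * (1 / 2) + 1 / 2) * u = u * ((2 * n + 1) / (2 * (n + 1))) := by
        rw [hv]; push_cast; field_simp; ring
      have h2 : 1 - u + (1 - v) * (1 / 2) * u = 1 - u * ((2 * n + 1) / (2 * (n + 1))) := by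
        rw [← h1]; ring
      rw [h1, h2]

end TI

/-- Tailored interpolation inequality (Lemma A.3 of the paper): for `k ≥ 4` and
`0 ≤ l ≤ k − 3`, with `q = 6(2k−3)/(2k−1)`, `p = 2q(k−3)/(2(k−3)+(q−4)l)` and the
interpolation exponents `a`, `b` defined below, one has `a + b = 1 − 1/(2k−4) ∈ (0,1)`
and there is a constant `C = C(k,l)` such that, for all compactly supported smooth
`φ, ψ : ℝ³ → ℝ`,
`‖|D^{2+l}φ||D^{k−1−l}ψ|‖_{L²} ≤ C‖D^kφ‖_{L²}^a ‖D^kψ‖_{L²}^b ‖D²φ‖_{L^q}^{1−a} ‖D²ψ‖_{L^q}^{1−b}`. -/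
theorem tailored_interpolation
    (k l : ℕ) (hk : 4 ≤ k) (hl : l ≤ k - 3)
    (q p a b : ℝ)
    (hq : q = 6 * (2 * (k : ℝ) - 3) / (2 * (k : ℝ) - 1))
    (hp : p = 2 * q * ((k : ℝ) - 3) / (2 * ((k : ℝ) - 3) + (q - 4) * (l : ℝ)))
    (ha : a = (1 / q - 1 / p + (l : ℝ) / 3) / (1 / q - 1 / 2 + ((k : ℝ) - 2) / 3))
    (hb : b = (1 / q - (p - 2) / (2 * p) + ((k : ℝ) - 3 - (l : ℝ)) / 3)
        / (1 / q - 1 / 2 + ((k : ℝ) - 2) / 3)) :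
    a + b = 1 - 1 / (2 * (k : ℝ) - 4) ∧ 0 < a + b ∧ a + b < 1 ∧
      ∃ C : ℝ≥0∞, C ≠ ⊤ ∧
        ∀ φ ψ : EuclideanSpace ℝ (Fin 3) → ℝ,
          ContDiff ℝ (⊤ : ℕ∞) φ → HasCompactSupport φ →
          ContDiff ℝ (⊤ : ℕ∞) ψ → HasCompactSupport ψ →
          eLpNorm (fun x => ‖iteratedFDeriv ℝ (2 + l) φ x‖
              * ‖iteratedFDeriv ℝ (k - 1 - l) ψ x‖) 2 volume ≤
            C * eLpNorm (fun x => ‖iteratedFDeriv ℝ k φ x‖) 2 volume ^ a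
              * eLpNorm (fun x => ‖iteratedFDeriv ℝ k ψ x‖) 2 volume ^ b
              * eLpNorm (fun x => ‖iteratedFDeriv ℝ 2 φ x‖) (ENNReal.ofReal q) volume ^ (1 - a)
              * eLpNorm (fun x => ‖iteratedFDeriv ℝ 2 ψ x‖) (ENNReal.ofReal q) volume ^ (1 - b) := by
  obtain ⟨n, rfl⟩ : ∃ n, k = n + 3 := ⟨k - 3, by omega⟩
  have hn : 1 ≤ n := by omega
  have hln : l ≤ n := by omega
  have hn1 : (1 : ℝ) ≤ n := by exact_mod_cast hn
  have hln' : (l : ℝ) ≤ n := by exact_mod_cast hln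
  obtain ⟨r, hr⟩ : ∃ r : ℝ, r = (2 * (n : ℝ) + 5) / (6 * (2 * n + 3)) := ⟨_, rfl⟩
  have hr0 : 0 < r := by rw [hr]; positivity
  have hqr : q = 1 / r := by 
    have h1 : 2 * ((n + 3 : ℕ) : ℝ) - 3 = 2 * n + 3 := by push_cast; ring
    have h2 : 2 * ((n + 3 : ℕ) : ℝ) - 1 = 2 * n + 5 := by push_cast; ring
    rw [hq, hr, h1, h2, one_div_div]
  have hr4 : r < 1 / 4 := by
    rw [hr, div_lt_div_iff₀ (by positivity) (by norm_num)]; linarith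
  obtain ⟨t, ht⟩ : ∃ t : ℝ, t = r + (l : ℝ) / n * (1 / 2 - 2 * r) := ⟨_, rfl⟩
  have ht0 : 0 < t := by
    have : 0 ≤ (l : ℝ) / n * (1 / 2 - 2 * r) := mul_nonneg (by positivity) (by linarith)
    linarith
  have hpt : p = 1 / t := by
    have hd : 2 * (((n + 3 : ℕ) : ℝ) - 3) + (q - 4) * (l : ℝ) = 2 * n / r * t := by
      rw [hqr, ht]; push_cast; field_simp; ring
    rw [hp, hd, hqr]; push_cast; field_simp; ring
  have hden : 1 / q - 1 / 2 + (((n + 3 : ℕ) : ℝ) - 2) / 3 =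
      (2 * n + 1) * (n + 1) / (3 * (2 * n + 3)) := by
    rw [hqr, one_div_one_div, hr]; push_cast; field_simp; ring
  have ha' : a = (l : ℝ) / n * ((2 * n + 1) / (2 * (n + 1))) := by
    rw [ha, hden, hqr, hpt, one_div_one_div, one_div_one_div, ht, hr]
    field_simp; ring
  have hcast : ((n - l : ℕ) : ℝ) = n - l := by push_cast [hln]; ring
  have hpp : (p - 2) / (2 * p) = 1 / 2 - t := by rw [hpt]; field_simp
  have htt : 1 / 2 - t = r + ((n - l : ℕ) : ℝ) / n * (1 / 2 - 2 * r) := by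
    rw [ht, hcast]; field_simp; ring
  have hb' : b = ((n - l : ℕ) : ℝ) / n * ((2 * n + 1) / (2 * (n + 1))) := by
    rw [hb, hden, hpp, htt, hqr, one_div_one_div, hcast, hr]
    push_cast
    field_simp; ring
  have hab : a + b = (2 * n + 1) / (2 * (n + 1)) := by
    rw [ha', hb', hcast]; field_simp; ring
  refine ⟨?_, ?_, ?_, ?_⟩
  · rw [hab]; push_cast
    have : 2 * ((n : ℝ) + 3) - 4 = 2 * (n + 1) := by ring
    rw [this]; field_simp; ring
  · rw [hab]; positivity
  · rw [hab, div_lt_one (by positivity)]; linarith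
  obtain ⟨D, hD, h⟩ := TI.gn n l hn hln r hr
  obtain ⟨D', hD', h'⟩ := TI.gn n (n - l) hn (by omega) r hr
  refine ⟨D * D', ENNReal.mul_ne_top hD hD', fun φ ψ hφ hφc hψ hψc => ?_⟩
  have g1 := h φ hφ hφc
  have g2 := h' ψ hψ hψc
  rw [← ha', ← ht] at g1
  rw [← hb', ← htt] at g2
  have ht2 : 0 < 1 / 2 - t := by
    have : 0 ≤ ((n - l : ℕ) : ℝ) / n * (1 / 2 - 2 * r) := mul_nonneg (by positivity) (by linarith)
    linarith
  have eN : ∀ (f : EuclideanSpace ℝ (Fin 3) → ℝ) (j : ℕ) (s : ℝ), 0 < s →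
      eLpNorm (fun x => ‖iteratedFDeriv ℝ j f x‖) (ENNReal.ofReal (1 / s)) volume = TI.N f j s := by
    intro f j s hs
    rw [TI.nrm_eq _ hs]; simp [TI.N]
  have e2' : ∀ f : EuclideanSpace ℝ (Fin 3) → ℝ,
      eLpNorm f 2 volume = eLpNorm f (ENNReal.ofReal (1 / (1 / 2))) volume := by
    intro f; congr 1; norm_num
  have ek : n + 3 - 1 - l = 2 + (n - l) := by omega
  rw [hqr, e2', e2', e2', ek, eN _ _ _ hr0, eN _ _ _ hr0, eN _ _ _ (by norm_num), eN _ _ _ (by norm_num),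
    TI.nrm_eq _ (by norm_num)]
  have hm := TI.nrm_mul (TI.contDiff_itd hφ (2 + l)).continuous.enorm.measurable
    (TI.contDiff_itd hψ (2 + (n - l))).continuous.enorm.measurable ht0 ht2
  rw [add_sub_cancel] at hm
  calc _ ≤ TI.N φ (2 + l) t * TI.N ψ (2 + (n - l)) (1 / 2 - t) := by
        refine le_trans (le_of_eq ?_) hm
        simp [enorm_mul]
    _ ≤ _ := mul_le_mul' g1 g2
    _ = _ := by ring
end
end
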